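/- arXiv:2106.04290 — 3 statements merged into one kernel-verified Lean document; each statement's English description precedes it below -/
import Mathlib

section
/- (Rademacher's theorem, weak-derivative part of Theorem 2.1(i)) Let f : ℝⁿ → ℝ be Lipschitz, so that by Rademacher's theorem its partial derivatives ∂f/∂xᵢ exist Lebesgue-almost everywhere. Then these almost-everywhere partial derivatives are also weak derivatives of f: for every smooth compactly supported function φ : ℝⁿ → ℝ and every index i ∈ {1,…,n}, ∫_{ℝⁿ} f(x)·(∂φ/∂xᵢ)(x) dx = −∫_{ℝⁿ} (∂f/∂xᵢ)(x)·φ(x) dx. -/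
open MeasureTheory NNReal

/-- **Rademacher's theorem, weak-derivative part.** For a Lipschitz function
`f : ℝⁿ → ℝ`, the almost-everywhere defined partial derivatives
`∂f/∂xᵢ = lineDeriv ℝ f · (eᵢ)` are weak derivatives of `f`: for every smooth
compactly supported `φ : ℝⁿ → ℝ` and every index `i`,
`∫ f ∂ᵢφ = − ∫ (∂ᵢ f) φ`. -/
theorem lipschitz_partialDeriv_is_weak_derivative
    (n : ℕ) (L : ℝ≥0) (f : EuclideanSpace ℝ (Fin n) → ℝ)
    (hf : LipschitzWith L f)
    (φ : EuclideanSpace ℝ (Fin n) → ℝ)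
    (hφ : ContDiff ℝ (⊤ : ℕ∞) φ) (hφc : HasCompactSupport φ) (i : Fin n) :
    ∫ x, f x * lineDeriv ℝ φ x (EuclideanSpace.single i (1 : ℝ)) ∂volume
      = - ∫ x, lineDeriv ℝ f x (EuclideanSpace.single i (1 : ℝ)) * φ x ∂volume := by
  obtain ⟨D, hD⟩ := ContDiff.lipschitzWith_of_hasCompactSupport hφc hφ (by simp)
  rw [hf.integral_lineDeriv_mul_eq hD hφc]
  simp only [lineDeriv_neg, mul_comm, mul_neg, integral_neg, neg_neg]
end

section
/- (Almost-everywhere chain rule; degree-0 case of Proposition 2.11) Let U, V ⊆ ℝⁿ be open sets, f : U → V a bi-Lipschitz map, and g : V → ℝ a Lipschitz map. Then for Lebesgue-almost every x ∈ U: f is differentiable at x, g is differentiable at f(x), the composition g ∘ f is differentiable at x, and D(g ∘ f)(x) = Dg(f(x)) ∘ Df(x). -/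
open MeasureTheory NNReal

/-- A Lipschitz map between subsets of a finite-dimensional space sends null sets to null sets. -/
lemma LipschitzOnWith.addHaar_image_eq_zero {E : Type*} [NormedAddCommGroup E] [NormedSpace ℝ E]
    [FiniteDimensional ℝ E] [MeasurableSpace E] [BorelSpace E] (μ : Measure E)
    [μ.IsAddHaarMeasure] {C : ℝ≥0} {f : E → E} {s : Set E} (hf : LipschitzOnWith C f s)
    (hs : μ s = 0) : μ (f '' s) = 0 := by
  set d := Module.finrank ℝ E
  have h₁ : Measure.hausdorffMeasure (X := E) d ≪ μ :=
    Measure.absolutelyContinuous_isAddHaarMeasure _ _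
  have h₂ : μ ≪ Measure.hausdorffMeasure (X := E) d :=
    Measure.absolutelyContinuous_isAddHaarMeasure _ _
  refine h₂ (le_antisymm ?_ zero_le)
  simpa [h₁ hs] using hf.hausdorffMeasure_image_le (Nat.cast_nonneg d)

/-- **Almost-everywhere chain rule.** If `f : U → V` is bi-Lipschitz between
open subsets of `ℝⁿ` and `g : V → ℝ` is Lipschitz, then for almost every
`x ∈ U`, `f` is differentiable at `x`, `g` is differentiable at `f x`,
`g ∘ f` is differentiable at `x`, and `D(g ∘ f)(x) = Dg(f x) ∘ Df(x)`. -/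
theorem ae_chain_rule_biLipschitz
    (n : ℕ) (U V : Set (EuclideanSpace ℝ (Fin n)))
    (hU : IsOpen U) (hV : IsOpen V)
    (f : EuclideanSpace ℝ (Fin n) → EuclideanSpace ℝ (Fin n))
    (L K : ℝ≥0)
    (hf : LipschitzOnWith L f U)
    (hbij : Set.BijOn f U V)
    (hanti : ∀ x ∈ U, ∀ y ∈ U, dist x y ≤ (K : ℝ) * dist (f x) (f y))
    (g : EuclideanSpace ℝ (Fin n) → ℝ) (Lg : ℝ≥0)
    (hg : LipschitzOnWith Lg g V) :
    ∀ᵐ x ∂(volume.restrict U),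
      DifferentiableAt ℝ f x ∧ DifferentiableAt ℝ g (f x) ∧
      DifferentiableAt ℝ (g ∘ f) x ∧
      fderiv ℝ (g ∘ f) x = (fderiv ℝ g (f x)).comp (fderiv ℝ f x) := by
  let h := Function.invFunOn f U
  have hinv : Set.InvOn h f U V := hbij.invOn_invFunOn
  have hmaps : Set.MapsTo h V U := hbij.surjOn.mapsTo_invFunOn
  have hh : LipschitzOnWith K h V := LipschitzOnWith.of_dist_le_mul fun x hx y hy => by
    simpa [hinv.2 hx, hinv.2 hy] using hanti _ (hmaps hx) _ (hmaps hy)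
  let N := {y | ¬ (y ∈ V → DifferentiableWithinAt ℝ g V y)}
  have hNV : N ⊆ V := fun y hy => (Classical.not_imp.1 hy).1
  have hN0 : volume N = 0 := hg.ae_differentiableWithinAt_of_mem
  have himage : volume (h '' N) = 0 := (hh.mono hNV).addHaar_image_eq_zero volume hN0
  rw [ae_restrict_iff' hU.measurableSet]
  filter_upwards [hf.ae_differentiableWithinAt_of_mem, measure_eq_zero_iff_ae_notMem.1 himage]
    with x hfx hx hxU
  have hfd : DifferentiableAt ℝ f x := (hfx hxU).differentiableAt (hU.mem_nhds hxU)
  have hfxV : f x ∈ V := hbij.mapsTo hxU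
  have hgd : DifferentiableAt ℝ g (f x) := by
    by_contra hcon
    refine hx ⟨f x, fun hd => hcon ((hd hfxV).differentiableAt (hV.mem_nhds hfxV)), ?_⟩
    exact hinv.1 hxU
  exact ⟨hfd, hgd, hgd.comp x hfd, fderiv_comp x hgd hfd⟩
end

section
/- (Almost-everywhere symplectic bi-Lipschitz maps preserve Lebesgue measure) Let n ≥ 1, let U, V ⊆ ℝ^{2n} be open sets, and let Φ : U → V be a bi-Lipschitz map such that for Lebesgue-almost every x ∈ U the derivative DΦ(x) (which exists almost everywhere by Rademacher's theorem) preserves the standard symplectic bilinear form: ω₀(DΦ(x)u, DΦ(x)v) = ω₀(u, v) for all u, v ∈ ℝ^{2n}. Then det DΦ(x) = 1 for almost every x ∈ U, and Φ preserves Lebesgue measure: for every measurable set A ⊆ U, the Lebesgue measure of Φ(A) equals the Lebesgue measure of A. -/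
open MeasureTheory NNReal

theorem EuclideanSpace.volume_image_eq_zero_of_lipschitzOnWith {ι : Type*} [Fintype ι]
    {f : EuclideanSpace ℝ ι → EuclideanSpace ℝ ι} {s : Set (EuclideanSpace ℝ ι)} {L : ℝ≥0}
    (hf : LipschitzOnWith L f s) (hs : volume s = 0) : volume (f '' s) = 0 := by
  set d : ℝ := (Module.finrank ℝ (EuclideanSpace ℝ ι) : ℝ)
  have hs' : Measure.hausdorffMeasure d s = 0 :=
    Measure.absolutelyContinuous_isAddHaarMeasure (Measure.hausdorffMeasure d) volume hs
  refine Measure.absolutelyContinuous_isAddHaarMeasure volume (Measure.hausdorffMeasure d) ?_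
  have := hf.hausdorffMeasure_image_le (d := d) (Nat.cast_nonneg _)
  rwa [hs', mul_zero, nonpos_iff_eq_zero] at this

/-- If `b` is a basis indexed by `l ⊕ l` and `f` preserves the bilinear form with matrix `J` in this
basis, then `f` has determinant one. -/
theorem LinearMap.det_eq_one_of_preserves_J {R E l : Type*} [CommRing R] [AddCommGroup E]
    [Module R E] [Fintype l] [DecidableEq l] (b : Module.Basis (l ⊕ l) R E) (f : E →ₗ[R] E)
    (hf : ∀ u v, b.repr (f u) ⬝ᵥ (Matrix.J l R).mulVec (b.repr (f v)) =
      b.repr u ⬝ᵥ (Matrix.J l R).mulVec (b.repr v)) :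
    LinearMap.det f = 1 := by
  rw [← LinearMap.det_toMatrix b]
  apply SymplecticGroup.det_eq_one
  rw [SymplecticGroup.mem_iff']
  ext i j
  have h := hf (b i) (b j)
  have hcol (k : l ⊕ l) : (b.repr (f (b k)) : l ⊕ l → R) = (LinearMap.toMatrix b b f).col k := by
    ext m
    simp [LinearMap.toMatrix_apply]
  rw [hcol, hcol] at h
  rw [Matrix.mul_assoc, Matrix.mul_apply]
  simpa [dotProduct, Matrix.mulVec, Matrix.mul_apply, Finsupp.single_apply] using h

/-- **A.e. symplectic bi-Lipschitz maps preserve Lebesgue measure.** If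
`Φ : U → V` is bi-Lipschitz between open subsets of `ℝ^{2n}` and for a.e.
`x ∈ U` the derivative `DΦ(x)` preserves the standard symplectic bilinear
form `ω₀`, then `det DΦ(x) = 1` for a.e. `x ∈ U` and `Φ` preserves Lebesgue
measure on measurable subsets of `U`. -/
theorem ae_symplectic_biLipschitz_measure_preserving
    (n : ℕ) (hn : 1 ≤ n)
    (U V : Set (EuclideanSpace ℝ (Fin (2 * n))))
    (hU : IsOpen U) (hV : IsOpen V)
    (Φ : EuclideanSpace ℝ (Fin (2 * n)) → EuclideanSpace ℝ (Fin (2 * n)))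
    (L K : ℝ≥0)
    (hΦ : LipschitzOnWith L Φ U)
    (hbij : Set.BijOn Φ U V)
    (hanti : ∀ x ∈ U, ∀ y ∈ U, dist x y ≤ (K : ℝ) * dist (Φ x) (Φ y))
    (ω₀ : EuclideanSpace ℝ (Fin (2 * n)) → EuclideanSpace ℝ (Fin (2 * n)) → ℝ)
    (hω₀ : ω₀ = fun u v => ∑ i : Fin n,
        (u ⟨i.1, by omega⟩ * v ⟨n + i.1, by omega⟩
          - u ⟨n + i.1, by omega⟩ * v ⟨i.1, by omega⟩))
    (hsymp : ∀ᵐ x ∂(volume.restrict U),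
        DifferentiableAt ℝ Φ x ∧
        ∀ u v, ω₀ (fderiv ℝ Φ x u) (fderiv ℝ Φ x v) = ω₀ u v) :
    (∀ᵐ x ∂(volume.restrict U), (fderiv ℝ Φ x).det = 1) ∧
      ∀ A ⊆ U, MeasurableSet A → volume (Φ '' A) = volume A := by
  have hdet : ∀ M : EuclideanSpace ℝ (Fin (2 * n)) →L[ℝ] EuclideanSpace ℝ (Fin (2 * n)),
      (∀ u v, ω₀ (M u) (M v) = ω₀ u v) → M.det = 1 := by
    intro M hM
    let e : Fin n ⊕ Fin n ≃ Fin (2 * n) := finSumFinEquiv.trans (finCongr (two_mul n).symm)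
    let b := (EuclideanSpace.basisFun (Fin (2 * n)) ℝ).toBasis.reindex e.symm
    have hω (u v) : ω₀ u v = -(b.repr u ⬝ᵥ (Matrix.J (Fin n) ℝ).mulVec (b.repr v)) := by
      have hl (w) (i : Fin n) : b.repr w (Sum.inl i) = w ⟨i.1, by omega⟩ := by
        rw [Module.Basis.repr_reindex_apply]; rfl
      have hr (w) (i : Fin n) : b.repr w (Sum.inr i) = w ⟨n + i.1, by omega⟩ := by
        rw [Module.Basis.repr_reindex_apply]; rfl
      simp [hω₀, dotProduct, Matrix.J, Matrix.mulVec, Fintype.sum_sum_type, hl, hr,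
        Matrix.one_apply]
      ring
    exact LinearMap.det_eq_one_of_preserves_J b M fun u v => by
      simpa [hω] using hM u v
  have hae : ∀ᵐ x ∂(volume.restrict U), (fderiv ℝ Φ x).det = 1 :=
    hsymp.mono fun x hx => hdet _ hx.2
  refine ⟨hae, fun A hAU hA => ?_⟩
  have hA_ae : ∀ᵐ x ∂(volume.restrict A), DifferentiableAt ℝ Φ x ∧ (fderiv ℝ Φ x).det = 1 :=
    ae_restrict_of_ae_restrict_of_subset hAU (hsymp.mono fun x hx => ⟨hx.1, hdet _ hx.2⟩)
  set S := {x | DifferentiableAt ℝ Φ x ∧ (fderiv ℝ Φ x).det = 1}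
  have hnull : volume (A \ S) = 0 := by
    rw [ae_restrict_iff' hA, ae_iff] at hA_ae
    convert hA_ae using 2
    ext x
    simp [S]
  have hAS : (A ∩ S : Set _) =ᵐ[volume] A := by
    rw [← Set.sdiff_sdiff_right_self]
    exact sdiff_null_ae_eq_self hnull
  have himage_null : volume (Φ '' (A \ S)) = 0 :=
    EuclideanSpace.volume_image_eq_zero_of_lipschitzOnWith
      (hΦ.mono (Set.sdiff_subset.trans hAU)) hnull
  have hmeas : NullMeasurableSet (A ∩ S) volume := hA.nullMeasurableSet.congr hAS.symm
  have hchange := lintegral_abs_det_fderiv_eq_addHaar_image₀ volume hmeas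
    (fun x hx => hx.2.1.hasFDerivAt.hasFDerivWithinAt)
    (hbij.injOn.mono (Set.inter_subset_left.trans hAU))
  have hone : ∫⁻ x in A ∩ S, ENNReal.ofReal |(fderiv ℝ Φ x).det| = volume (A ∩ S) := by
    rw [← setLIntegral_one]
    refine lintegral_congr_ae ?_
    filter_upwards [ae_restrict_mem₀ hmeas] with x hx
    simp [hx.2.2]
  calc volume (Φ '' A) = volume (Φ '' (A ∩ S) ∪ Φ '' (A \ S)) := by
        rw [← Set.image_union, Set.inter_union_sdiff]
    _ = volume (Φ '' (A ∩ S)) := by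
        rw [measure_congr (union_ae_eq_left_of_ae_eq_empty (ae_eq_empty.2 himage_null))]
    _ = volume A := by rw [← hchange, hone, measure_congr hAS]
end
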